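/- Let d ≥ 5 and let Q be a facet of a 2-neighborly d-polytope P such that Q is itself 2-neighborly, Q is a pyramid, and Q has k facets. Then either P is a pyramid, or P has at least k+3 facets. -/

import Mathlib

open Set

/-- A polytope is the convex hull of a finite set of points. -/
def IsPolytope {N : ℕ} (P : Set (Fin N → ℝ)) : Prop :=
  ∃ S : Finset (Fin N → ℝ), P = convexHull ℝ (S : Set (Fin N → ℝ))

/-- The dimension of a set: the dimension of its affine span. -/
noncomputable def pdim {N : ℕ} (P : Set (Fin N → ℝ)) : ℕ :=
  Module.finrank ℝ (affineSpan ℝ P).direction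

/-- A vertex is a 0-dimensional (exposed) face, i.e. an exposed singleton. -/
def IsVertex {N : ℕ} (P : Set (Fin N → ℝ)) (v : Fin N → ℝ) : Prop :=
  IsExposed ℝ P {v}

/-- The set of vertices of `P`. -/
def vertexSet {N : ℕ} (P : Set (Fin N → ℝ)) : Set (Fin N → ℝ) :=
  {v | IsVertex P v}

/-- A facet is a nonempty exposed face of dimension one less than the polytope. -/
def IsFacetOf {N : ℕ} (P F : Set (Fin N → ℝ)) : Prop :=
  IsExposed ℝ P F ∧ F.Nonempty ∧ pdim F + 1 = pdim P

/-- The set of facets of `P`. -/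
def facetSet {N : ℕ} (P : Set (Fin N → ℝ)) : Set (Set (Fin N → ℝ)) :=
  {F | IsFacetOf P F}

/-- A polytope is 2-neighborly if every pair of distinct vertices is the vertex set of
an edge (1-dimensional face), i.e. the segment between them is an exposed face. -/
def TwoNeighborly {N : ℕ} (P : Set (Fin N → ℝ)) : Prop :=
  ∀ u v : Fin N → ℝ, IsVertex P u → IsVertex P v → u ≠ v →
    IsExposed ℝ P (convexHull ℝ {u, v}) ∧ pdim (convexHull ℝ ({u, v} : Set (Fin N → ℝ))) = 1

/-- A polytope is 2-simplicial if every 2-dimensional face has exactly 3 vertices. -/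
def TwoSimplicial {N : ℕ} (P : Set (Fin N → ℝ)) : Prop :=
  ∀ F : Set (Fin N → ℝ), IsExposed ℝ P F → F.Nonempty → pdim F = 2 →
    (vertexSet F).ncard = 3

/-- A polytope is a pyramid if some vertex (the apex) is not in the affine span
of the remaining vertices. -/
def IsPyramid {N : ℕ} (P : Set (Fin N → ℝ)) : Prop :=
  ∃ v : Fin N → ℝ, IsVertex P v ∧ v ∉ affineSpan ℝ (vertexSet P \ {v})

/-- `P` is a pyramid over `Q`: `Q` is a facet of `P` and `P` is the convex hull of `Q`
together with one additional point (the apex) not in the affine span of `Q`. -/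
def IsPyramidOver {N : ℕ} (P Q : Set (Fin N → ℝ)) : Prop :=
  IsFacetOf P Q ∧ ∃ a : Fin N → ℝ, a ∉ affineSpan ℝ Q ∧ P = convexHull ℝ (Q ∪ {a})

/-- `P` is a `k`-fold pyramid over `Q`. -/
def IsKFoldPyramidOver {N : ℕ} : ℕ → Set (Fin N → ℝ) → Set (Fin N → ℝ) → Prop
  | 0, P, Q => P = Q
  | k + 1, P, Q => ∃ R : Set (Fin N → ℝ), IsKFoldPyramidOver k R Q ∧ IsPyramidOver P R

section PolytopeFaces

variable {N : ℕ} {P Q F G : Set (Fin N → ℝ)}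

lemma isExposed_levelSet {l : StrongDual ℝ (Fin N → ℝ)} {c : ℝ} (h : ∀ x ∈ P, l x ≤ c) :
    IsExposed ℝ P {x ∈ P | l x = c} := by
  rintro ⟨x, hxP, hx⟩
  refine ⟨l, Set.ext fun y => ⟨fun hy => ⟨hy.1, fun z hz => ?_⟩, fun hy => ⟨hy.1, ?_⟩⟩⟩
  · rw [hy.2]
    exact h z hz
  · exact le_antisymm (h y hy.1) (hx ▸ hy.2 x hxP)

lemma IsExposed.exists_levelSet (hF : IsExposed ℝ P F) (hne : F.Nonempty) :
    ∃ (l : StrongDual ℝ (Fin N → ℝ)) (c : ℝ), (∀ x ∈ P, l x ≤ c) ∧ F = {x ∈ P | l x = c} := by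
  obtain ⟨l, hl⟩ := hF hne
  obtain ⟨x, hx⟩ := hne
  have hx' := hl ▸ hx
  refine ⟨l, l x, hx'.2, ?_⟩
  rw [hl]
  ext y
  exact ⟨fun hy => ⟨hy.1, le_antisymm (hx'.2 y hy.1) (hy.2 x hx'.1)⟩,
    fun hy => ⟨hy.1, fun z hz => hy.2 ▸ hx'.2 z hz⟩⟩

lemma le_of_mem_convexHull {S : Set (Fin N → ℝ)} {l : StrongDual ℝ (Fin N → ℝ)} {c : ℝ}
    (h : ∀ s ∈ S, l s ≤ c) : ∀ x ∈ convexHull ℝ S, l x ≤ c :=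
  convexHull_min (t := {x | l x ≤ c}) h (convex_halfSpace_le l.toLinearMap.isLinear c)

lemma IsExposed.eq_convexHull {S : Set (Fin N → ℝ)} (hS : S.Finite)
    (hF : IsExposed ℝ (convexHull ℝ S) F) : F = convexHull ℝ (S ∩ F) := by
  have hFc : Convex ℝ F := hF.convex (convex_convexHull ℝ S)
  have hFk : IsCompact F := hF.isCompact (hS.isCompact_convexHull ℝ)
  refine Subset.antisymm ?_ (convexHull_min inter_subset_right hFc)
  have hsub : F.extremePoints ℝ ⊆ S ∩ F := fun x hx =>
    ⟨extremePoints_convexHull_subset (hF.isExtreme.extremePoints_subset_extremePoints hx), hx.1⟩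
  calc F = closure (convexHull ℝ (F.extremePoints ℝ)) :=
        (closure_convexHull_extremePoints hFk hFc).symm
    _ ⊆ convexHull ℝ (S ∩ F) :=
        closure_minimal (convexHull_mono hsub) ((hS.inter_of_left F).isClosed_convexHull ℝ)

lemma IsPolytope.of_isExposed (hP : IsPolytope P) (hF : IsExposed ℝ P F) : IsPolytope F := by
  obtain ⟨S, rfl⟩ := hP
  have h := hF.eq_convexHull S.finite_toSet
  refine ⟨(S.finite_toSet.inter_of_left F).toFinset, ?_⟩
  rwa [Set.Finite.coe_toFinset]

lemma IsPolytope.finite_setOf_isExposed (hP : IsPolytope P) : {F | IsExposed ℝ P F}.Finite := by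
  obtain ⟨S, rfl⟩ := hP
  refine (S.finite_toSet.finite_subsets.image (convexHull ℝ)).subset fun F hF => ?_
  exact ⟨S ∩ F, inter_subset_left, (IsExposed.eq_convexHull S.finite_toSet hF).symm⟩

lemma IsPolytope.finite_facetSet (hP : IsPolytope P) : (facetSet P).Finite :=
  hP.finite_setOf_isExposed.subset fun _ hF => hF.1

lemma IsPolytope.subset_convexHull_vertexSet (hP : IsPolytope P) :
    P ⊆ convexHull ℝ (vertexSet P) := by
  obtain ⟨S, rfl⟩ := hP
  have hS := S.finite_toSet
  set P := convexHull ℝ (S : Set (Fin N → ℝ)) with hPdef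
  have hPc : Convex ℝ P := convex_convexHull ℝ _
  have hsub : P.extremePoints ℝ ⊆ vertexSet P ∩ S := by
    intro x hx
    have hxS : x ∈ (S : Set (Fin N → ℝ)) := extremePoints_convexHull_subset hx
    refine ⟨?_, hxS⟩
    have hxn : x ∉ convexHull ℝ ((S : Set (Fin N → ℝ)) \ {x}) := fun h =>
      (hPc.mem_extremePoints_iff_mem_sdiff_convexHull_sdiff.1 hx).2
        (convexHull_mono (sdiff_subset_sdiff_left (subset_convexHull ℝ _)) h)
    obtain ⟨l, u, hlu, hux⟩ := geometric_hahn_banach_closed_point (convex_convexHull ℝ _)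
      ((hS.subset sdiff_subset).isClosed_convexHull ℝ) hxn
    have hlt : ∀ s ∈ (S : Set (Fin N → ℝ)), s ≠ x → l s < l x := fun s hs hne =>
      (hlu s (subset_convexHull ℝ _ ⟨hs, hne⟩)).trans hux
    have hle : ∀ y ∈ P, l y ≤ l x := le_of_mem_convexHull fun s hs => by
      by_cases h : s = x
      · rw [h]
      · exact (hlt s hs h).le
    have hexp := isExposed_levelSet hle
    have heq := hexp.eq_convexHull hS
    have hsing : (S : Set (Fin N → ℝ)) ∩ {y ∈ P | l y = l x} = {x} := by
      ext s
      refine ⟨fun hs => by_contra fun h => (hlt s hs.1 h).ne hs.2.2, ?_⟩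
      rintro rfl
      exact ⟨hxS, hx.1, rfl⟩
    rw [hsing, convexHull_singleton] at heq
    rw [heq] at hexp
    exact hexp
  calc P = closure (convexHull ℝ (P.extremePoints ℝ)) :=
        (closure_convexHull_extremePoints (hS.isCompact_convexHull ℝ) hPc).symm
    _ ⊆ convexHull ℝ (vertexSet P ∩ S) :=
        closure_minimal (convexHull_mono hsub) ((hS.inter_of_right _).isClosed_convexHull ℝ)
    _ ⊆ _ := convexHull_mono inter_subset_left

/-- A face of a face of a polytope is a face of the polytope. -/
lemma IsPolytope.isExposed_trans (hP : IsPolytope P) (hQ : IsExposed ℝ P Q)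
    (hG : IsExposed ℝ Q G) : IsExposed ℝ P G := by
  intro hne
  obtain ⟨l, c, hl, hQeq⟩ := hQ.exists_levelSet (hne.mono hG.subset)
  obtain ⟨m, e, hm, hGeq⟩ := hG.exists_levelSet hne
  obtain ⟨S, rfl⟩ := hP
  obtain ⟨M, hM⟩ := (S.finite_toSet.image fun s => (m s - e) / (c - l s)).bddAbove
  set h : StrongDual ℝ (Fin N → ℝ) := (M + 1) • l + m with hh
  have hval : ∀ x, h x = (M + 1) * l x + m x := fun x => by simp [hh]
  have hstrict : ∀ s ∈ (S : Set (Fin N → ℝ)), s ∉ Q → h s < (M + 1) * c + e := by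
    intro s hs hsQ
    have hsP := subset_convexHull ℝ (S : Set (Fin N → ℝ)) hs
    have hlt : l s < c := lt_of_le_of_ne (hl s hsP) fun h => hsQ (hQeq ▸ ⟨hsP, h⟩)
    have h1 : (m s - e) / (c - l s) ≤ M := hM (mem_image_of_mem _ hs)
    rw [div_le_iff₀ (by linarith)] at h1
    rw [hval]
    nlinarith
  have hQval : ∀ x ∈ Q, h x = (M + 1) * c + m x := fun x hx => by
    rw [hval, (hQeq ▸ hx : x ∈ {x ∈ _ | l x = c}).2]
  have hle : ∀ x ∈ convexHull ℝ (S : Set (Fin N → ℝ)), h x ≤ (M + 1) * c + e :=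
    le_of_mem_convexHull fun s hs => by
      by_cases hsQ : s ∈ Q
      · rw [hQval s hsQ]
        linarith [hm s hsQ]
      · exact (hstrict s hs hsQ).le
  have hexp := isExposed_levelSet hle
  have hsubQ : {x ∈ convexHull ℝ (S : Set (Fin N → ℝ)) | h x = (M + 1) * c + e} ⊆ Q := by
    rw [hexp.eq_convexHull S.finite_toSet]
    exact convexHull_min (fun s hs => by_contra fun hsQ => (hstrict s hs.1 hsQ).ne hs.2.2)
      (hQ.convex (convex_convexHull ℝ _))
  have hGE : G = {x ∈ convexHull ℝ (S : Set (Fin N → ℝ)) | h x = (M + 1) * c + e} := by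
    ext x
    refine ⟨fun hx => ?_, fun hx => ?_⟩
    · have hxQ := hG.subset hx
      rw [hGeq] at hx
      exact ⟨hQ.subset hxQ, by rw [hQval x hxQ, hx.2]⟩
    · have hxQ := hsubQ hx
      rw [hGeq]
      exact ⟨hxQ, by linarith [hQval x hxQ, hx.2]⟩
  rw [hGE] at hne ⊢
  exact hexp hne

lemma IsExposed.mem_of_mem_affineSpan (hF : IsExposed ℝ P F) {x : Fin N → ℝ} (hx : x ∈ P)
    (hxF : x ∈ affineSpan ℝ F) : x ∈ F := by
  obtain ⟨l, c, -, hFeq⟩ := hF.exists_levelSet ((affineSpan_nonempty ℝ).1 ⟨x, hxF⟩)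
  have hle : affineSpan ℝ F ≤
      (affineSpan ℝ {c}).comap l.toLinearMap.toAffineMap := by
    rw [affineSpan_le]
    intro y hy
    rw [hFeq] at hy
    simp [hy.2]
  have := hle hxF
  rw [hFeq]
  exact ⟨hx, by simpa using this⟩

lemma affineSubspace_eq_of_finrank_le {A B : AffineSubspace ℝ (Fin N → ℝ)}
    (hne : (A : Set (Fin N → ℝ)).Nonempty) (hle : A ≤ B)
    (hrank : Module.finrank ℝ B.direction ≤ Module.finrank ℝ A.direction) : A = B :=
  AffineSubspace.eq_of_direction_eq_of_nonempty_of_le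
    (Submodule.eq_of_le_of_finrank_le (AffineSubspace.direction_le hle) hrank) hne hle

lemma IsExposed.eq_of_pdim_le (hF : IsExposed ℝ P F) (hne : F.Nonempty)
    (h : pdim P ≤ pdim F) : F = P := by
  have := affineSubspace_eq_of_finrank_le ((affineSpan_nonempty ℝ).2 hne)
    (affineSpan_mono ℝ hF.subset) h
  exact hF.subset.antisymm fun x hx =>
    hF.mem_of_mem_affineSpan hx (this ▸ subset_affineSpan ℝ P hx)

lemma IsPolytope.exists_isExposed_ssubset (hP : IsPolytope P) (hF : IsExposed ℝ P F)
    (hne : F.Nonempty) {v : Fin N → ℝ} (hv : v ∈ P) (hvF : v ∉ F)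
    (hdim : pdim F + 1 ≠ pdim P) : ∃ G, IsExposed ℝ P G ∧ F ⊂ G ∧ v ∉ G := by
  have hlt : pdim F + 1 < pdim P := by
    refine lt_of_le_of_ne ?_ hdim
    by_contra h
    exact hvF (hF.eq_of_pdim_le hne (by omega) ▸ hv)
  obtain ⟨S, rfl⟩ := hP
  set A := affineSpan ℝ (insert v F) with hA
  have hvA : v ∈ A := subset_affineSpan ℝ _ (mem_insert v F)
  have hArank : Module.finrank ℝ A.direction ≤ pdim F + 1 := by
    rw [hA, direction_affineSpan, pdim, direction_affineSpan]
    exact finrank_vectorSpan_insert_le_set ℝ F v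
  obtain ⟨u, huS, huA⟩ : ∃ u ∈ (S : Set (Fin N → ℝ)), u ∉ A := by
    by_contra! hcon
    have hle : affineSpan ℝ (convexHull ℝ (S : Set (Fin N → ℝ))) ≤ A := by
      rw [affineSpan_convexHull]
      exact affineSpan_le.2 hcon
    have := Submodule.finrank_mono (AffineSubspace.direction_le hle)
    rw [← pdim] at this
    omega
  have hud : u - v ∉ A.direction := fun h =>
    huA ((AffineSubspace.vsub_right_mem_direction_iff_mem hvA u).1 h)
  obtain ⟨f, hfu, hfA⟩ := Submodule.exists_le_ker_of_notMem hud
  obtain ⟨l, c, hl, hFeq⟩ := hF.exists_levelSet hne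
  -- a functional vanishing on the direction of `A` and strictly larger at `u` than at `v`
  obtain ⟨m, hmu, hmA⟩ : ∃ m : StrongDual ℝ (Fin N → ℝ), m v < m u ∧ ∀ x ∈ A, m x = m v := by
    have key : ∀ x ∈ A, f x = f v := fun x hx => by
      have := hfA (AffineSubspace.vsub_mem_direction hx hvA)
      rw [LinearMap.mem_ker, vsub_eq_sub, map_sub] at this
      linarith
    rw [map_sub] at hfu
    rcases lt_or_gt_of_ne hfu with h | h
    · exact ⟨LinearMap.toContinuousLinearMap (-f), by simp; linarith,
        fun x hx => by simp [key x hx]⟩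
    · exact ⟨LinearMap.toContinuousLinearMap f, by simp; linarith,
        fun x hx => by simp [key x hx]⟩
  have hmF : ∀ x ∈ F, m x = m v := fun x hx =>
    hmA x (subset_affineSpan ℝ _ (mem_insert_of_mem v hx))
  have hSP := subset_convexHull ℝ (S : Set (Fin N → ℝ))
  have hlt_l : ∀ x ∈ convexHull ℝ (S : Set (Fin N → ℝ)), x ∉ F → l x < c := fun x hx hxF =>
    lt_of_le_of_ne (hl x hx) fun h => hxF (hFeq ▸ ⟨hx, h⟩)
  -- the first point hit when the supporting hyperplane is rotated about `A`
  obtain ⟨w, hw, hwmin⟩ := (S.filter fun s => m v < m s).exists_min_image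
    (fun s => (c - l s) / (m s - m v)) ⟨u, Finset.mem_filter.2 ⟨huS, hmu⟩⟩
  rw [Finset.mem_filter] at hw
  have hwF : w ∉ F := fun h => hw.2.ne (hmF w h).symm
  set t := (c - l w) / (m w - m v) with ht
  have ht0 : 0 < t := div_pos (by linarith [hlt_l w (hSP hw.1) hwF]) (by linarith [hw.2])
  set h : StrongDual ℝ (Fin N → ℝ) := l + t • m with hh
  have hval : ∀ x, h x = l x + t * m x := fun x => by simp [hh]
  have hle : ∀ x ∈ convexHull ℝ (S : Set (Fin N → ℝ)), h x ≤ c + t * m v := by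
    refine le_of_mem_convexHull fun s hs => ?_
    rw [hval]
    rcases le_or_gt (m s) (m v) with hms | hms
    · nlinarith [hl s (hSP hs)]
    · have h1 : t ≤ _ := hwmin s (Finset.mem_filter.2 ⟨hs, hms⟩)
      rw [le_div_iff₀ (by linarith)] at h1
      linarith
  refine ⟨_, isExposed_levelSet hle,
    ⟨fun x hx => ⟨hF.subset hx, ?_⟩, fun hsub => hwF (hsub ?_)⟩, ?_⟩
  · rw [hval, hmF x hx, (hFeq ▸ hx : x ∈ {x ∈ _ | l x = c}).2]
  · refine ⟨hSP hw.1, ?_⟩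
    have : t * (m w - m v) = c - l w := div_mul_cancel₀ _ (by linarith [hw.2])
    rw [hval]
    linarith
  · rintro ⟨-, hv'⟩
    rw [hval] at hv'
    linarith [hlt_l v hv hvF]

/-- A nonempty proper face of a polytope is cut out by facets. -/
lemma IsPolytope.exists_facet (hP : IsPolytope P) (hF : IsExposed ℝ P F)
    (hne : F.Nonempty) {v : Fin N → ℝ} (hv : v ∈ P) (hvF : v ∉ F) :
    ∃ G, IsFacetOf P G ∧ F ⊆ G ∧ v ∉ G := by
  have hfin : {G | IsExposed ℝ P G ∧ F ⊆ G ∧ v ∉ G}.Finite :=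
    hP.finite_setOf_isExposed.subset fun _ h => h.1
  obtain ⟨G, hG⟩ := hfin.exists_maximal ⟨F, hF, Subset.rfl, hvF⟩
  refine ⟨G, ⟨hG.prop.1, hne.mono hG.prop.2.1, ?_⟩, hG.prop.2⟩
  by_contra hdim
  obtain ⟨H, hH, hGH, hvH⟩ := hP.exists_isExposed_ssubset hG.prop.1
    (hne.mono hG.prop.2.1) hv hG.prop.2.2 hdim
  exact hGH.2 (hG.le_of_ge ⟨hH, hG.prop.2.1.trans hGH.1, hvH⟩ hGH.1)

lemma IsVertex.mem {v : Fin N → ℝ} (hv : IsVertex P v) : v ∈ P := IsExposed.subset hv rfl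

lemma IsVertex.notMem_convexHull {v : Fin N → ℝ} (hv : IsVertex P v) (hP : Convex ℝ P)
    {T : Set (Fin N → ℝ)} (hT : T ⊆ P) (hvT : v ∉ T) : v ∉ convexHull ℝ T := fun h =>
  hvT <| extremePoints_convexHull_subset <|
    inter_extremePoints_subset_extremePoints_of_subset (convexHull_min hT hP)
      ⟨h, exposedPoints_subset_extremePoints (mem_exposedPoints_iff_exposed_singleton.2 hv)⟩

lemma exists_vertex_notMem_of_not_isPyramid (hnp : ¬ IsPyramid P) {v : Fin N → ℝ}
    (hv : IsVertex P v) (hF : IsExposed ℝ P F) (hvF : v ∉ F) :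
    ∃ w, IsVertex P w ∧ w ≠ v ∧ w ∉ F := by
  by_contra! hcon
  refine hnp ⟨v, hv, fun h => hvF (hF.mem_of_mem_affineSpan hv.mem ?_)⟩
  exact affineSpan_mono ℝ (fun w hw => hcon w hw.1 hw.2) h

/-- A vertex of a 2-neighborly polytope that is not a pyramid is missed by at least
three facets. -/
lemma three_le_ncard_facets_notMem (hP : IsPolytope P) (hnb : TwoNeighborly P)
    (hnp : ¬ IsPyramid P) {v : Fin N → ℝ} (hv : IsVertex P v) :
    3 ≤ {F | F ∈ facetSet P ∧ v ∉ F}.ncard := by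
  have hPc : Convex ℝ P := by
    obtain ⟨S, rfl⟩ := hP
    exact convex_convexHull ℝ _
  have hpair : ∀ u w, IsVertex P u → IsVertex P w → u ≠ v → w ≠ v →
      ∃ F, IsFacetOf P F ∧ v ∉ F ∧ u ∈ F ∧ w ∈ F := by
    intro u w hu hw huv hwv
    have hexp : IsExposed ℝ P (convexHull ℝ {u, w}) := by
      by_cases h : u = w
      · rw [h, pair_eq_singleton, convexHull_singleton]
        exact hw
      · exact (hnb u w hu hw h).1
    have hvn : v ∉ convexHull ℝ {u, w} :=
      hv.notMem_convexHull hPc (pair_subset hu.mem hw.mem) (by simp [huv.symm, hwv.symm])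
    have hsub := subset_convexHull ℝ ({u, w} : Set (Fin N → ℝ))
    obtain ⟨F, hF, hsubF, hvF⟩ := hP.exists_facet hexp ⟨u, hsub (by simp)⟩ hv.mem hvn
    exact ⟨F, hF, hvF, hsubF (hsub (by simp)), hsubF (hsub (by simp))⟩
  obtain ⟨w₀, hw₀, hw₀v, -⟩ :=
    exists_vertex_notMem_of_not_isPyramid hnp hv isExposed_empty (notMem_empty v)
  obtain ⟨F₁, hF₁, hvF₁, -⟩ := hpair w₀ w₀ hw₀ hw₀ hw₀v hw₀v
  obtain ⟨w₁, hw₁, hw₁v, hw₁F⟩ := exists_vertex_notMem_of_not_isPyramid hnp hv hF₁.1 hvF₁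
  obtain ⟨F₂, hF₂, hvF₂, hw₁F₂, -⟩ := hpair w₁ w₁ hw₁ hw₁ hw₁v hw₁v
  obtain ⟨w₂, hw₂, hw₂v, hw₂F⟩ := exists_vertex_notMem_of_not_isPyramid hnp hv hF₂.1 hvF₂
  obtain ⟨F₃, hF₃, hvF₃, hw₁F₃, hw₂F₃⟩ := hpair w₁ w₂ hw₁ hw₂ hw₁v hw₂v
  have h₁₂ : F₁ ≠ F₂ := fun h => hw₁F (h ▸ hw₁F₂)
  have h₁₃ : F₁ ≠ F₃ := fun h => hw₁F (h ▸ hw₁F₃)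
  have h₂₃ : F₂ ≠ F₃ := fun h => hw₂F (h ▸ hw₂F₃)
  rw [← ncard_eq_three.2 ⟨F₁, F₂, F₃, h₁₂, h₁₃, h₂₃, rfl⟩]
  refine ncard_le_ncard ?_ (hP.finite_facetSet.subset fun _ h => h.1)
  rintro F (rfl | rfl | rfl)
  exacts [⟨hF₁, hvF₁⟩, ⟨hF₂, hvF₂⟩, ⟨hF₃, hvF₃⟩]

/-- At most one facet of a pyramid misses its apex. -/
lemma IsPolytope.facet_eq_of_apex_notMem (hQ : IsPolytope Q) {v : Fin N → ℝ}
    (hv : IsVertex Q v) (hvs : v ∉ affineSpan ℝ (vertexSet Q \ {v}))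
    (hF : IsFacetOf Q F) (hvF : v ∉ F) (hG : IsFacetOf Q G) (hvG : v ∉ G) : F = G := by
  have key : ∀ H, IsFacetOf Q H → v ∉ H →
      affineSpan ℝ H = affineSpan ℝ (vertexSet Q \ {v}) := by
    intro H hH hvH
    have hle : affineSpan ℝ H ≤ affineSpan ℝ (vertexSet Q \ {v}) := by
      calc affineSpan ℝ H ≤ affineSpan ℝ (convexHull ℝ (vertexSet H)) :=
            affineSpan_mono ℝ (hQ.of_isExposed hH.1).subset_convexHull_vertexSet
        _ = affineSpan ℝ (vertexSet H) := affineSpan_convexHull _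
        _ ≤ affineSpan ℝ (vertexSet Q \ {v}) := affineSpan_mono ℝ fun w (hw : IsVertex H w) =>
            ⟨hQ.isExposed_trans hH.1 hw, fun h => hvH (h ▸ hw.mem)⟩
    have hne : (affineSpan ℝ H : Set (Fin N → ℝ)).Nonempty := (affineSpan_nonempty ℝ).2 hH.2.1
    refine affineSubspace_eq_of_finrank_le hne hle ?_
    by_contra hlt
    have hleQ : affineSpan ℝ (vertexSet Q \ {v}) ≤ affineSpan ℝ Q :=
      affineSpan_mono ℝ fun w hw => hw.1.mem
    have hdim := hH.2.2
    unfold pdim at hdim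
    have := affineSubspace_eq_of_finrank_le (hne.mono hle) hleQ (by omega)
    exact hvs (this ▸ subset_affineSpan ℝ Q hv.mem)
  have hspan := (key F hF hvF).trans (key G hG hvG).symm
  refine Subset.antisymm (fun x hx => ?_) fun x hx => ?_
  · exact hG.1.mem_of_mem_affineSpan (hF.1.subset hx) (hspan ▸ subset_affineSpan ℝ F hx)
  · exact hF.1.mem_of_mem_affineSpan (hG.1.subset hx) (hspan ▸ subset_affineSpan ℝ G hx)

/-- A facet of a facet `Q` is the intersection of `Q` with another facet. -/
lemma IsPolytope.exists_adjacent_facet (hP : IsPolytope P) (hQ : IsFacetOf P Q)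
    (hG : IsFacetOf Q G) : ∃ F, IsFacetOf P F ∧ F ≠ Q ∧ F ∩ Q = G := by
  obtain ⟨x, hxQ, hxG⟩ : ∃ x ∈ Q, x ∉ G := by
    by_contra! hcon
    have := hG.2.2
    rw [hG.1.subset.antisymm hcon] at this
    omega
  obtain ⟨F, hF, hGF, hxF⟩ := hP.exists_facet (hP.isExposed_trans hQ.1 hG.1) hG.2.1
    (hQ.1.subset hxQ) hxG
  refine ⟨F, hF, fun h => hxF (h ▸ hxQ), ?_⟩
  have hsub : G ⊆ F ∩ Q := subset_inter hGF hG.1.subset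
  have hexp : IsExposed ℝ Q (F ∩ Q) :=
    (hF.1.inter hQ.1).mono hQ.1.subset inter_subset_right
  have hne := hG.2.1.mono hsub
  refine ((hG.1.mono hexp.subset hsub).eq_of_pdim_le hG.2.1 ?_).symm
  by_contra hlt
  have hdim := hG.2.2
  exact hxF ((hexp.eq_of_pdim_le hne (by omega)).symm ▸ hxQ : x ∈ F ∩ Q).1

/-- For a point `v` of a facet `Q` of `P`, strictly fewer facets of `Q` than of `P`
contain `v`. -/
lemma IsPolytope.ncard_facets_mem_lt (hP : IsPolytope P) (hQ : IsFacetOf P Q)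
    {v : Fin N → ℝ} (hv : v ∈ Q) :
    {G | G ∈ facetSet Q ∧ v ∈ G}.ncard < {F | F ∈ facetSet P ∧ v ∈ F}.ncard := by
  have hfin : {F | F ∈ facetSet P ∧ v ∈ F}.Finite := hP.finite_facetSet.subset fun _ h => h.1
  have hQmem : Q ∈ {F | F ∈ facetSet P ∧ v ∈ F} := ⟨hQ, hv⟩
  choose! f hf hfQ hfG using fun G (hG : G ∈ facetSet Q) => hP.exists_adjacent_facet hQ hG
  refine lt_of_le_of_lt ?_ (ncard_sdiff_singleton_lt_of_mem hQmem hfin)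
  refine ncard_le_ncard_of_injOn f ?_ ?_ (hfin.subset sdiff_subset)
  · rintro G ⟨hG, hvG⟩
    refine ⟨⟨hf G hG, ?_⟩, hfQ G hG⟩
    rw [← hfG G hG] at hvG
    exact hvG.1
  · rintro G ⟨hG, -⟩ H ⟨hH, -⟩ hGH
    rw [← hfG G hG, ← hfG H hH, hGH]

end PolytopeFaces

/-- Let `d ≥ 5` and let `Q` be a facet of a 2-neighborly `d`-polytope `P` such that
`Q` is itself 2-neighborly, `Q` is a pyramid, and `Q` has `k` facets. Then either `P` is a
pyramid, or `P` has at least `k + 3` facets. -/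
theorem pyramid_facet_dichotomy
    (d k : ℕ) (hd : 5 ≤ d) {N : ℕ} (P Q : Set (Fin N → ℝ))
    (hP : IsPolytope P) (hdim : pdim P = d) (hnb : TwoNeighborly P)
    (hQ : IsFacetOf P Q) (hQnb : TwoNeighborly Q) (hQpyr : IsPyramid Q)
    (hk : (facetSet Q).ncard = k) :
    IsPyramid P ∨ k + 3 ≤ (facetSet P).ncard := by
  by_cases hnp : IsPyramid P
  · exact Or.inl hnp
  right
  obtain ⟨v, hv, hvs⟩ := hQpyr
  have hQpoly := hP.of_isExposed hQ.1
  have hmiss := three_le_ncard_facets_notMem hP hnb hnp (hP.isExposed_trans hQ.1 hv)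
  have hthrough := hP.ncard_facets_mem_lt hQ hv.mem
  have hone : {G | G ∈ facetSet Q ∧ v ∉ G}.ncard ≤ 1 :=
    (ncard_le_one (hQpoly.finite_facetSet.subset fun _ h => h.1)).2 fun F hF G hG =>
      hQpoly.facet_eq_of_apex_notMem hv hvs hF.1 hF.2 hG.1 hG.2
  have hsplit : ∀ R : Set (Fin N → ℝ), IsPolytope R → (facetSet R).ncard =
      {G | G ∈ facetSet R ∧ v ∈ G}.ncard + {G | G ∈ facetSet R ∧ v ∉ G}.ncard := fun R hR =>
    (ncard_inter_add_ncard_sdiff_eq_ncard (facetSet R) {G | v ∈ G} hR.finite_facetSet).symm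
  have hQsplit := hsplit Q hQpoly
  have hPsplit := hsplit P hP
  omega
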